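/- Let T > 0, let V : ℝⁿ → ℝ be smooth, let Σ : ℝⁿ → ℝ^{n×n} be smooth with Σ(x) symmetric positive definite for every x, and let p : [0,T] × ℝⁿ → (0,∞) be continuous, smooth on (0,T) × ℝⁿ, with each p_t a probability density, and satisfy the Fokker–Planck equation ∂_t p_t(x) = div( Σ(x) (∇ log p_t(x) + ∇V(x)) p_t(x) ) on (0,T) × ℝⁿ. Set ℓ_t(x) := p_t(x) e^{V(x)} and H(t) := ∫ p_t(x) log ℓ_t(x) dx. Assume: (i) for every t ∈ [0,T] the functions x ↦ p_t(x) log ℓ_t(x) and x ↦ ⟨∇ log ℓ_t(x), Σ(x) ∇ log ℓ_t(x)⟩ p_t(x) are Lebesgue integrable; (ii) H is continuous on [0,T] and differentiable on (0,T) with H′(t) = ∫ ∂_t( p_t(x) log ℓ_t(x) ) dx; (iii) for every t ∈ (0,T) the vector field x ↦ e^{−V(x)} (1 + log ℓ_t(x)) Σ(x) ∇ℓ_t(x) has Lebesgue-integrable divergence whose integral over ℝⁿ vanishes. Then the relative entropy function t ↦ H(t) is non-increasing on [0,T]. -/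

import Mathlib

open MeasureTheory Matrix

/-- Gradient of a scalar field on `ℝⁿ` (components are partial derivatives). -/
noncomputable def vgrad {n : ℕ} (f : (Fin n → ℝ) → ℝ) (x : Fin n → ℝ) : Fin n → ℝ :=
  fun i => fderiv ℝ f x (Pi.single i 1)

/-- Divergence of a vector field on `ℝⁿ`. -/
noncomputable def vdiv {n : ℕ} (v : (Fin n → ℝ) → Fin n → ℝ) (x : Fin n → ℝ) : ℝ :=
  ∑ i, fderiv ℝ (fun y => v y i) x (Pi.single i 1)

/-- Product rule for the divergence of a scalar multiple of a vector field. -/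
theorem vdiv_smul {n : ℕ} {f : (Fin n → ℝ) → ℝ} {W : (Fin n → ℝ) → Fin n → ℝ} {x : Fin n → ℝ}
    (hf : DifferentiableAt ℝ f x) (hW : ∀ i, DifferentiableAt ℝ (fun y => W y i) x) :
    vdiv (fun y => f y • W y) x = f x * vdiv W x + vgrad f x ⬝ᵥ W x := by
  simp only [vdiv, vgrad, dotProduct, Finset.mul_sum, ← Finset.sum_add_distrib]
  refine Finset.sum_congr rfl fun i _ => ?_
  simp only [Pi.smul_apply, smul_eq_mul]
  rw [fderiv_fun_mul hf (hW i)]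
  simp
  ring

theorem vgrad_add {n : ℕ} {f g : (Fin n → ℝ) → ℝ} {x : Fin n → ℝ}
    (hf : DifferentiableAt ℝ f x) (hg : DifferentiableAt ℝ g x) :
    vgrad (fun y => f y + g y) x = vgrad f x + vgrad g x := by
  ext i
  simp [vgrad, fderiv_fun_add hf hg]

theorem vgrad_exp {n : ℕ} {f : (Fin n → ℝ) → ℝ} {x : Fin n → ℝ}
    (hf : DifferentiableAt ℝ f x) :
    vgrad (fun y => Real.exp (f y)) x = Real.exp (f x) • vgrad f x := by
  ext i
  simp [vgrad, fderiv_exp hf]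

theorem vgrad_const_add {n : ℕ} (c : ℝ) (f : (Fin n → ℝ) → ℝ) (x : Fin n → ℝ) :
    vgrad (fun y => c + f y) x = vgrad f x := by
  ext i
  simp [vgrad]

/-- The components of `ρ Σ ∇f` are differentiable when `ρ`, `Σ` and `f` are smooth. -/
theorem differentiable_smul_mulVec_vgrad {n : ℕ} {ρ f : (Fin n → ℝ) → ℝ}
    {A : (Fin n → ℝ) → Matrix (Fin n) (Fin n) ℝ} (hρ : ContDiff ℝ (⊤ : ℕ∞) ρ)
    (hA : ∀ i j, ContDiff ℝ (⊤ : ℕ∞) fun x => A x i j) (hf : ContDiff ℝ (⊤ : ℕ∞) f) (i : Fin n) :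
    Differentiable ℝ (fun y => (ρ y • (A y *ᵥ vgrad f y)) i) := by
  have hf' : Differentiable ℝ (fderiv ℝ f) :=
    (hf.fderiv_right (m := 1) (by norm_cast)).differentiable (by norm_num)
  have hρ' : Differentiable ℝ ρ := hρ.differentiable (by simp)
  have hA' : ∀ j, Differentiable ℝ fun x => A x i j := fun j => (hA i j).differentiable (by simp)
  simp only [Pi.smul_apply, smul_eq_mul, mulVec, dotProduct, vgrad]
  fun_prop

/-- Pointwise entropy dissipation identity: if `∂ₜp = div (p Σ ∇(log p + V))`, then
`(1 + log ℓ) ∂ₜp` is the divergence of `e^{-V} (1 + log ℓ) Σ ∇ℓ` minus the Fisher information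
density, where `ℓ = p e^V`. -/
theorem one_add_log_mul_vdiv {n : ℕ} {V ρ ℓ : (Fin n → ℝ) → ℝ}
    {A : (Fin n → ℝ) → Matrix (Fin n) (Fin n) ℝ} (hV : ContDiff ℝ (⊤ : ℕ∞) V)
    (hA : ∀ i j, ContDiff ℝ (⊤ : ℕ∞) fun x => A x i j) (hρ : ContDiff ℝ (⊤ : ℕ∞) ρ)
    (hpos : ∀ x, 0 < ρ x) (hℓ : ∀ x, ℓ x = ρ x * Real.exp (V x)) (x : Fin n → ℝ) :
    (1 + Real.log (ℓ x)) * vdiv (fun y =>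
        ρ y • (A y *ᵥ (vgrad (fun z => Real.log (ρ z)) y + vgrad V y))) x
      = vdiv (fun y =>
          (Real.exp (-V y) * (1 + Real.log (ℓ y))) • (A y *ᵥ vgrad ℓ y)) x
        - (vgrad (fun z => Real.log (ℓ z)) x ⬝ᵥ
            (A x *ᵥ vgrad (fun z => Real.log (ℓ z)) x)) * ρ x := by
  have hlogρ : ContDiff ℝ (⊤ : ℕ∞) fun z => Real.log (ρ z) := hρ.log fun z => (hpos z).ne'
  have hlog : (fun z => Real.log (ℓ z)) = fun z => Real.log (ρ z) + V z := by
    ext z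
    rw [hℓ, Real.log_mul (hpos z).ne' (Real.exp_pos _).ne', Real.log_exp]
  have hL : ContDiff ℝ (⊤ : ℕ∞) fun z => Real.log (ℓ z) := by
    rw [hlog]
    exact hlogρ.add hV
  have hLd : Differentiable ℝ fun z => Real.log (ℓ z) := hL.differentiable (by simp)
  have hgrad (y) : vgrad (fun z => Real.log (ρ z)) y + vgrad V y
      = vgrad (fun z => Real.log (ℓ z)) y := by
    rw [hlog, vgrad_add (hlogρ.differentiable (by simp) y) (hV.differentiable (by simp) y)]
  have hℓpos (z) : 0 < ℓ z := by
    rw [hℓ]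
    exact mul_pos (hpos z) (Real.exp_pos _)
  have hgradℓ (y) : vgrad ℓ y = ℓ y • vgrad (fun z => Real.log (ℓ z)) y := by
    have h := vgrad_exp (hLd y)
    simpa only [Real.exp_log (hℓpos _)] using h
  have hfield : (fun y => (Real.exp (-V y) * (1 + Real.log (ℓ y))) • (A y *ᵥ vgrad ℓ y))
      = fun y => (1 + Real.log (ℓ y)) •
          (ρ y • (A y *ᵥ vgrad (fun z => Real.log (ℓ z)) y)) := by
    ext1 y
    rw [hgradℓ, mulVec_smul, smul_smul, smul_smul]
    congr 1
    rw [hℓ y, Real.exp_neg]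
    field_simp
  simp only [hgrad]
  rw [hfield, vdiv_smul ((hLd x).const_add 1)
    (fun i => differentiable_smul_mulVec_vgrad hρ hA hL i x), vgrad_const_add, dotProduct_smul,
    smul_eq_mul]
  ring

/-- the relative entropy function `t ↦ H(t)` is non-increasing on `[0,T]`. -/
theorem stmt_11 {n : ℕ} (T : ℝ) (hT : 0 < T)
    (V : (Fin n → ℝ) → ℝ) (hV : ContDiff ℝ (⊤ : ℕ∞) V)
    (Sm : (Fin n → ℝ) → Matrix (Fin n) (Fin n) ℝ)
    (hSm : ∀ i j, ContDiff ℝ (⊤ : ℕ∞) fun x => Sm x i j)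
    (hsym : ∀ x, (Sm x).IsSymm) (hpd : ∀ x, (Sm x).PosDef)
    (p : ℝ → (Fin n → ℝ) → ℝ)
    (hpcont : ContinuousOn (fun q : ℝ × (Fin n → ℝ) => p q.1 q.2)
      (Set.Icc 0 T ×ˢ Set.univ))
    (hpsm : ContDiffOn ℝ (⊤ : ℕ∞) (fun q : ℝ × (Fin n → ℝ) => p q.1 q.2)
      (Set.Ioo 0 T ×ˢ Set.univ))
    (hppos : ∀ t ∈ Set.Icc (0:ℝ) T, ∀ x, 0 < p t x)
    (hprob : ∀ t ∈ Set.Icc (0:ℝ) T, Integrable (p t) ∧ ∫ x, p t x = 1)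
    (hFP : ∀ t ∈ Set.Ioo (0:ℝ) T, ∀ x : Fin n → ℝ,
      deriv (fun s => p s x) t
        = vdiv (fun y =>
            p t y • (Sm y *ᵥ (vgrad (fun z => Real.log (p t z)) y + vgrad V y))) x)
    -- the likelihood ratio ℓ_t(x) = p_t(x) e^{V(x)}
    (ℓ : ℝ → (Fin n → ℝ) → ℝ) (hℓ : ∀ t x, ℓ t x = p t x * Real.exp (V x))
    -- the relative entropy H(t) = ∫ p_t log ℓ_t dx
    (H : ℝ → ℝ) (hH : ∀ t, H t = ∫ x, p t x * Real.log (ℓ t x))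
    -- (i) integrability of the entropy and Fisher-information integrands
    (hi : ∀ t ∈ Set.Icc (0:ℝ) T,
      Integrable (fun x => p t x * Real.log (ℓ t x)) ∧
      Integrable (fun x =>
        (vgrad (fun z => Real.log (ℓ t z)) x ⬝ᵥ
          (Sm x *ᵥ vgrad (fun z => Real.log (ℓ t z)) x)) * p t x))
    -- (ii) H is continuous on [0,T] and differentiable on (0,T), with derivative obtained
    -- by differentiating under the integral sign
    (hii₁ : ContinuousOn H (Set.Icc 0 T))
    (hii₂ : ∀ t ∈ Set.Ioo (0:ℝ) T,
      HasDerivAt H (∫ x, deriv (fun s => p s x * Real.log (ℓ s x)) t) t)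
    -- (iii) the divergence of x ↦ e^{−V}(1 + log ℓ_t) Σ ∇ℓ_t is integrable with vanishing
    -- integral
    (hiii : ∀ t ∈ Set.Ioo (0:ℝ) T,
      Integrable (fun x => vdiv (fun y =>
        (Real.exp (-V y) * (1 + Real.log (ℓ t y))) • (Sm y *ᵥ vgrad (ℓ t) y)) x) ∧
      ∫ x, vdiv (fun y =>
        (Real.exp (-V y) * (1 + Real.log (ℓ t y))) • (Sm y *ᵥ vgrad (ℓ t) y)) x = 0) :
    ∀ t₀ t : ℝ, 0 ≤ t₀ → t₀ ≤ t → t ≤ T → H t ≤ H t₀ := by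
  have hcda : ∀ t ∈ Set.Ioo (0:ℝ) T, ∀ x : Fin n → ℝ,
      ContDiffAt ℝ (⊤ : ℕ∞) (fun q : ℝ × (Fin n → ℝ) => p q.1 q.2) (t, x) := fun t ht x =>
    hpsm.contDiffAt ((isOpen_Ioo.prod isOpen_univ).mem_nhds ⟨ht, Set.mem_univ x⟩)
  have hspace : ∀ t ∈ Set.Ioo (0:ℝ) T, ContDiff ℝ (⊤ : ℕ∞) (p t) := fun t ht =>
    contDiff_iff_contDiffAt.2 fun x =>
      (hcda t ht x).comp x (contDiff_prodMk_right t).contDiffAt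
  have htime : ∀ t ∈ Set.Ioo (0:ℝ) T, ∀ x, DifferentiableAt ℝ (fun s => p s x) t :=
    fun t ht x =>
      ((hcda t ht x).comp t (contDiff_prodMk_left x).contDiffAt).differentiableAt (by simp)
  have hderiv : ∀ t ∈ Set.Ioo (0:ℝ) T, ∀ x : Fin n → ℝ,
      deriv (fun s => p s x * Real.log (ℓ s x)) t
        = (1 + Real.log (ℓ t x)) * deriv (fun s => p s x) t := by
    intro t ht x
    have hp := hppos t (Set.Ioo_subset_Icc_self ht) x
    have hd := (htime t ht x).hasDerivAt
    have hne : p t x * Real.exp (V x) ≠ 0 := (mul_pos hp (Real.exp_pos _)).ne'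
    simp only [hℓ]
    rw [(hd.fun_mul ((hd.mul_const (Real.exp (V x))).log hne)).deriv]
    field_simp
    ring
  have hanti : AntitoneOn H (Set.Icc 0 T) := by
    refine antitoneOn_of_deriv_nonpos (convex_Icc 0 T) hii₁ ?_ ?_
    · rw [interior_Icc]
      exact fun t ht => (hii₂ t ht).differentiableAt.differentiableWithinAt
    · rw [interior_Icc]
      intro t ht
      have htc := Set.Ioo_subset_Icc_self ht
      rw [(hii₂ t ht).deriv]
      simp only [hderiv t ht, hFP t ht,
        one_add_log_mul_vdiv hV hSm (hspace t ht) (hppos t htc) (hℓ t)]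
      rw [integral_sub (hiii t ht).1 (hi t htc).2, (hiii t ht).2, zero_sub, neg_nonpos]
      refine integral_nonneg fun x => mul_nonneg ?_ (hppos t htc x).le
      simpa using (hpd x).posSemidef.dotProduct_mulVec_nonneg
        (vgrad (fun z => Real.log (ℓ t z)) x)
  exact fun t₀ t h0 h1 h2 => hanti ⟨h0, h1.trans h2⟩ ⟨h0.trans h1, h2⟩ h1
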